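/- (Multiplicativity of the Weil kernels) Let g₁, g₂ ∈ SL(2, ZMod p) be such that g₁ − I, g₂ − I and g₁g₂ − I are all invertible. Then the kernel-formula operators satisfy ρ(g₁) ∘ ρ(g₂) = ρ(g₁·g₂), where ρ(g) = p⁻¹ · σ(−det(κ(g) + I)) · Σ_{v ∈ (ZMod p)²} ψ(4⁻¹·ω(κ(g)·v, v)) · π(v, 0) and κ(g) = (g + I)(g − I)⁻¹. -/

import Mathlib

open scoped BigOperators

noncomputable section

namespace DFTWeil

open scoped Classical

/-- Multiplication of the Heisenberg group `H = (V × V) × Z`,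
`(v,z)·(v',z') = (v+v', z+z'+2⁻¹ ω(v,v'))` with `ω((t,w),(t',w')) = t w' - w t'`. -/
def hMul {p : ℕ} (a b : (ZMod p × ZMod p) × ZMod p) : (ZMod p × ZMod p) × ZMod p :=
  (a.1 + b.1, a.2 + b.2 + (2 : ZMod p)⁻¹ * (a.1.1 * b.1.2 - a.1.2 * b.1.1))

/-- The additive character `ψ(z) = exp(2πi z/p)`. -/
def psi (p : ℕ) (z : ZMod p) : ℂ :=
  Complex.exp (2 * Real.pi * Complex.I * (z.val : ℂ) / p)

/-- The standard realization of the Heisenberg representation: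
`(π((t,w),z) f)(x) = ψ(z + 2⁻¹ t w + w x) f(x+t)`. -/
def heis (p : ℕ) (h : (ZMod p × ZMod p) × ZMod p) :
    (ZMod p → ℂ) →ₗ[ℂ] (ZMod p → ℂ) where
  toFun f x := psi p (h.2 + (2 : ZMod p)⁻¹ * h.1.1 * h.1.2 + h.1.2 * x) * f (x + h.1.1)
  map_add' f g := by funext x; simp [mul_add]
  map_smul' c f := by funext x; simp [Pi.smul_apply, smul_eq_mul]; ring

/-- The Legendre character `σ` of `ZMod p` (extended by `0` at `0`). -/
def sgm (p : ℕ) (a : ZMod p) : ℂ := if a = 0 then 0 else if IsSquare a then 1 else -1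

/-- Action of a `2 × 2` matrix on a column vector `v ∈ (ZMod p)²`. -/
def matVec {p : ℕ} (m : Matrix (Fin 2) (Fin 2) (ZMod p)) (v : ZMod p × ZMod p) :
    ZMod p × ZMod p :=
  (m 0 0 * v.1 + m 0 1 * v.2, m 1 0 * v.1 + m 1 1 * v.2)

/-- The symplectic form `ω((t,w),(t',w')) = t w' - w t'`. -/
def omg {p : ℕ} (v w : ZMod p × ZMod p) : ZMod p := v.1 * w.2 - v.2 * w.1

/-- The Cayley transform `κ(g) = (g+I)(g-I)⁻¹`. -/
def cayley {p : ℕ} (g : Matrix (Fin 2) (Fin 2) (ZMod p)) : Matrix (Fin 2) (Fin 2) (ZMod p) :=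
  (g + 1) * (g - 1)⁻¹

/-- The Weil operator given by the kernel formula
`ρ(g) = p⁻¹ σ(-det(κ(g)+I)) Σ_v ψ(4⁻¹ ω(κ(g)v,v)) π(v,0)`. -/
def weilOp (p : ℕ) [Fact p.Prime] (g : Matrix (Fin 2) (Fin 2) (ZMod p)) :
    (ZMod p → ℂ) →ₗ[ℂ] (ZMod p → ℂ) :=
  (p : ℂ)⁻¹ • sgm p (-((cayley g + 1).det)) •
    ∑ v : ZMod p × ZMod p,
      psi p ((4 : ZMod p)⁻¹ * omg (matVec (cayley g) v) v) • heis p (v, 0)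

/-- The character `psi` is Mathlib's standard additive character of `ZMod p`. -/
lemma psi_eq_stdAddChar (p : ℕ) [NeZero p] (z : ZMod p) : psi p z = ZMod.stdAddChar z := by
  rw [ZMod.stdAddChar_apply, ZMod.toCircle_apply, psi]

lemma psi_add (p : ℕ) [NeZero p] (x y : ZMod p) : psi p (x + y) = psi p x * psi p y := by
  simp only [psi_eq_stdAddChar, AddChar.map_add_eq_mul]

section Field

variable {p : ℕ} [Fact p.Prime]

lemma two_ne_zero_of_ne_two (hp : p ≠ 2) : (2 : ZMod p) ≠ 0 :=
  Ring.two_ne_zero (by rwa [ZMod.ringChar_zmod_n])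

lemma sgm_eq_quadraticChar (a : ZMod p) : sgm p a = (quadraticChar (ZMod p) a : ℂ) := by
  rw [quadraticChar_apply, quadraticCharFun, sgm]
  split_ifs <;> simp

lemma sgm_mul (a b : ZMod p) : sgm p (a * b) = sgm p a * sgm p b := by
  rw [sgm_eq_quadraticChar, sgm_eq_quadraticChar, sgm_eq_quadraticChar, map_mul, Int.cast_mul]

lemma sgm_sq_mul {b : ZMod p} (hb : b ≠ 0) (a : ZMod p) : sgm p (b ^ 2 * a) = sgm p a := by
  rw [sgm_eq_quadraticChar, map_mul, quadraticChar_sq_one' hb, one_mul, sgm_eq_quadraticChar]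

/-- The sum of a nontrivial character over the line. -/
lemma sum_psi_mul (a : ZMod p) : ∑ x : ZMod p, psi p (x * a) = if a = 0 then (p : ℂ) else 0 := by
  simp only [psi_eq_stdAddChar]
  rw [AddChar.sum_mulShift a (ZMod.isPrimitive_stdAddChar p), ZMod.card]
  split_ifs <;> simp

/-- The quadratic Gauss sum `∑ ψ(t²)`, in its multiplicative form. -/
def quadGauss (p : ℕ) [Fact p.Prime] : ℂ :=
  gaussSum ((quadraticChar (ZMod p)).ringHomComp (Int.castRingHom ℂ)) ZMod.stdAddChar

lemma quadGauss_sq (hp : p ≠ 2) : quadGauss p * quadGauss p = sgm p (-1) * p := by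
  have hne : (quadraticChar (ZMod p)).ringHomComp (Int.castRingHom ℂ) ≠ 1 := by
    rw [Ne, MulChar.ringHomComp_eq_one_iff Int.cast_injective]
    exact quadraticChar_ne_one (by rwa [ZMod.ringChar_zmod_n])
  have h := gaussSum_sq hne ((quadraticChar_isQuadratic _).comp _) (ZMod.isPrimitive_stdAddChar p)
  rw [sgm_eq_quadraticChar, quadGauss, ← sq, h, ZMod.card]
  simp

lemma sum_psi_mul_sq (hp : p ≠ 2) {a : ZMod p} (ha : a ≠ 0) :
    ∑ t : ZMod p, psi p (a * t ^ 2) = sgm p a * quadGauss p := by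
  have hfib : ∑ t : ZMod p, psi p (a * t ^ 2) = ∑ b : ZMod p, (sgm p b + 1) * psi p (a * b) := by
    rw [← Finset.sum_fiberwise (g := fun t : ZMod p => t ^ 2)]
    refine Finset.sum_congr rfl fun b _ => ?_
    rw [Finset.sum_congr rfl (g := fun _ => psi p (a * b)) (by simp +contextual),
      Finset.sum_const, nsmul_eq_mul, sgm_eq_quadraticChar]
    have h := quadraticChar_card_sqrts (F := ZMod p) (by rwa [ZMod.ringChar_zmod_n]) b
    congr 1
    rw [← Int.cast_one, ← Int.cast_add, ← h, Int.cast_natCast, Nat.cast_inj]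
    congr 1
    ext t
    simp
  have hzero : ∑ b : ZMod p, psi p (a * b) = 0 := by
    simpa [mul_comm, ha] using sum_psi_mul a
  rw [hfib]
  simp only [add_mul, one_mul, Finset.sum_add_distrib, hzero, add_zero]
  rw [quadGauss, gaussSum, Finset.mul_sum,
    ← Equiv.sum_comp (Equiv.mulLeft₀ a ha) (fun c => sgm p a * (_ * ZMod.stdAddChar c))]
  refine Finset.sum_congr rfl fun b _ => ?_
  have haa : sgm p a * sgm p a = 1 := by
    rw [← sgm_mul, ← sq, ← mul_one (a ^ 2), sgm_sq_mul ha, sgm_eq_quadraticChar]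
    simp
  simp only [Equiv.mulLeft₀_apply, MulChar.ringHomComp_apply, eq_intCast]
  rw [← sgm_eq_quadraticChar (a * b), sgm_mul, ← psi_eq_stdAddChar, ← mul_assoc, ← mul_assoc, haa, one_mul]

/-- The Gauss sum of a nondegenerate binary quadratic form. -/
lemma sum_psi_binary (hp : p ≠ 2) (a b c : ZMod p) (h : a * c - b ^ 2 ≠ 0) :
    ∑ v : ZMod p × ZMod p, psi p (a * v.1 ^ 2 + 2 * b * v.1 * v.2 + c * v.2 ^ 2) =
      sgm p (-(a * c - b ^ 2)) * p := by
  have h2 := two_ne_zero_of_ne_two hp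
  have key : ∀ a b c : ZMod p, a * c - b ^ 2 ≠ 0 → a ≠ 0 →
      ∑ w : ZMod p, ∑ t : ZMod p, psi p (a * t ^ 2 + 2 * b * t * w + c * w ^ 2) =
      sgm p (-(a * c - b ^ 2)) * p := by
    intro a b c h ha
    have hd : c - b ^ 2 / a ≠ 0 := by
      intro h0
      apply h
      field_simp at h0
      linear_combination h0
    have hin : ∀ w : ZMod p, ∑ t : ZMod p, psi p (a * t ^ 2 + 2 * b * t * w + c * w ^ 2) =
        sgm p a * quadGauss p * psi p ((c - b ^ 2 / a) * w ^ 2) := by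
      intro w
      rw [← sum_psi_mul_sq hp ha, Finset.sum_mul,
        ← Equiv.sum_comp (Equiv.addRight (b * w / a)) (fun t => psi p (a * t ^ 2) * _)]
      refine Finset.sum_congr rfl fun t _ => ?_
      rw [← psi_add]
      congr 1
      simp only [Equiv.coe_addRight]
      field_simp
      ring
    simp only [hin]
    rw [← Finset.mul_sum, sum_psi_mul_sq hp hd]
    have hs : -(a * c - b ^ 2) = a * (c - b ^ 2 / a) * (-1) := by
      field_simp
    rw [hs, sgm_mul, sgm_mul]
    linear_combination (sgm p a * sgm p (c - b ^ 2 / a)) * quadGauss_sq hp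
  by_cases ha : a = 0
  · by_cases hc : c = 0
    · subst ha hc
      have hb : b ≠ 0 := by rintro rfl; simp at h
      have hs : -(0 * 0 - b ^ 2) = b ^ 2 * 1 := by ring
      rw [hs, sgm_sq_mul hb, Fintype.sum_prod_type_right]
      have hin : ∀ w : ZMod p, ∑ t : ZMod p,
          psi p (0 * t ^ 2 + 2 * b * t * w + 0 * w ^ 2) = if w = 0 then (p : ℂ) else 0 := by
        intro w
        have := sum_psi_mul (2 * b * w)
        simp only [mul_eq_zero, h2, hb, false_or] at this
        rw [← this]
        refine Finset.sum_congr rfl fun t _ => ?_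
        congr 1
        ring
      rw [Finset.sum_congr rfl fun w _ => hin w]
      simp [sgm_eq_quadraticChar]
    · rw [Fintype.sum_prod_type]
      have := key c b a (by rwa [mul_comm]) hc
      rw [mul_comm c a] at this
      rw [← this]
      refine Finset.sum_congr rfl fun t _ => Finset.sum_congr rfl fun w _ => ?_
      congr 1
      ring
  · rw [Fintype.sum_prod_type_right]
    exact key a b c h ha

section Cayley

variable {g g₁ g₂ : Matrix (Fin 2) (Fin 2) (ZMod p)}

lemma cayley_eq (h : (g - 1).det ≠ 0) : cayley g = 1 + 2 * (g - 1)⁻¹ := by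
  have hu : (g - 1) * (g - 1)⁻¹ = 1 := Matrix.mul_nonsing_inv _ h.isUnit
  have : g + 1 = (g - 1) + 2 := by
    have h2 : (2 : Matrix (Fin 2) (Fin 2) (ZMod p)) = 1 + 1 := one_add_one_eq_two.symm
    rw [h2]
    abel
  rw [cayley, this, add_mul, hu]

lemma cayley_apply_one_one (hg : g.det = 1) : cayley g 1 1 = -cayley g 0 0 := by
  rw [Matrix.det_fin_two] at hg
  simp only [cayley, Matrix.inv_def, Matrix.adjugate_fin_two, Matrix.mul_apply, Fin.sum_univ_two,
    Matrix.smul_apply, Matrix.of_apply, Matrix.cons_val', Matrix.add_apply, Matrix.sub_apply,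
    smul_eq_mul]
  simp
  linear_combination (2 * (g - 1).det⁻¹) * hg

lemma det_cayley_add_one_mul (hg : g.det = 1) (h : (g - 1).det ≠ 0) :
    (cayley g + 1).det * (g - 1).det = 4 := by
  have hu : (g - 1)⁻¹ * (g - 1) = 1 := Matrix.nonsing_inv_mul _ h.isUnit
  have : (cayley g + 1) * (g - 1) = (2 : ZMod p) • g := by
    rw [cayley, add_mul, mul_assoc, hu, two_smul, mul_one, one_mul]
    abel
  rw [← Matrix.det_mul, this, Matrix.det_smul, hg]
  norm_num

lemma sgm_neg_det_cayley_add_one (hp : p ≠ 2) (hg : g.det = 1) (h : (g - 1).det ≠ 0) :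
    sgm p (-(cayley g + 1).det) = sgm p (-(g - 1).det) := by
  have h2 := two_ne_zero_of_ne_two hp
  have e : (g - 1).det ^ 2 * -(cayley g + 1).det = 2 ^ 2 * -(g - 1).det := by
    linear_combination -(g - 1).det * det_cayley_add_one_mul hg h
  rw [← sgm_sq_mul h, e, sgm_sq_mul h2]

lemma cayley_add_cayley (h₁ : (g₁ - 1).det ≠ 0) (h₂ : (g₂ - 1).det ≠ 0) :
    (g₁ - 1) * (cayley g₁ + cayley g₂) * (g₂ - 1) = (2 : ZMod p) • (g₁ * g₂ - 1) := by
  have hu₁ : (g₁ - 1) * (g₁ - 1)⁻¹ = 1 := Matrix.mul_nonsing_inv _ h₁.isUnit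
  have hu₂ : (g₂ - 1)⁻¹ * (g₂ - 1) = 1 := Matrix.nonsing_inv_mul _ h₂.isUnit
  rw [cayley_eq h₁, cayley_eq h₂]
  have e : (g₁ - 1) * (1 + 2 * (g₁ - 1)⁻¹ + (1 + 2 * (g₂ - 1)⁻¹)) * (g₂ - 1) =
      2 * ((g₁ - 1) * (g₂ - 1)) + 2 * ((g₁ - 1) * (g₁ - 1)⁻¹) * (g₂ - 1) +
        2 * (g₁ - 1) * ((g₂ - 1)⁻¹ * (g₂ - 1)) := by
    noncomm_ring
  rw [e, hu₁, hu₂, two_smul]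
  noncomm_ring

lemma det_cayley_add_cayley (h₁ : (g₁ - 1).det ≠ 0) (h₂ : (g₂ - 1).det ≠ 0) :
    (g₁ - 1).det * (cayley g₁ + cayley g₂).det * (g₂ - 1).det = 4 * (g₁ * g₂ - 1).det := by
  rw [← Matrix.det_mul, ← Matrix.det_mul, cayley_add_cayley h₁ h₂, Matrix.det_smul]
  norm_num

lemma det_cayley_add_cayley_ne_zero (hp : p ≠ 2) (h₁ : (g₁ - 1).det ≠ 0)
    (h₂ : (g₂ - 1).det ≠ 0) (h₁₂ : (g₁ * g₂ - 1).det ≠ 0) :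
    (cayley g₁ + cayley g₂).det ≠ 0 := by
  have h2 := two_ne_zero_of_ne_two hp
  intro h
  have := det_cayley_add_cayley h₁ h₂
  rw [h, show (4 : ZMod p) = 2 ^ 2 by norm_num] at this
  simp [h2, h₁₂] at this

/-- The cocycle identity for the Legendre symbols of the kernels. -/
lemma sgm_cocycle (hp : p ≠ 2) (h₁ : (g₁ - 1).det ≠ 0) (h₂ : (g₂ - 1).det ≠ 0) :
    sgm p (-(g₁ - 1).det) * sgm p (-(g₂ - 1).det) * sgm p (-(cayley g₁ + cayley g₂).det) =
      sgm p (-(g₁ * g₂ - 1).det) := by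
  have h2 := two_ne_zero_of_ne_two hp
  rw [← sgm_mul, ← sgm_mul, ← sgm_sq_mul h2 (-(g₁ * g₂ - 1).det)]
  congr 1
  linear_combination -det_cayley_add_cayley h₁ h₂

/-- The Cayley transform of a product. -/
lemma cayley_mul (hp : p ≠ 2) (h₁ : (g₁ - 1).det ≠ 0) (h₂ : (g₂ - 1).det ≠ 0)
    (h₁₂ : (g₁ * g₂ - 1).det ≠ 0) :
    cayley (g₁ * g₂) =
      cayley g₂ - (cayley g₂ - 1) * ((cayley g₁ + cayley g₂)⁻¹ * (cayley g₂ + 1)) := by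
  have hC := det_cayley_add_cayley_ne_zero hp h₁ h₂ h₁₂
  have hsum := cayley_add_cayley h₁ h₂
  have hu₁ : (g₁ - 1) * (g₁ - 1)⁻¹ = 1 := Matrix.mul_nonsing_inv _ h₁.isUnit
  have hu₂ : (g₂ - 1) * (g₂ - 1)⁻¹ = 1 := Matrix.mul_nonsing_inv _ h₂.isUnit
  have hCr := Matrix.mul_nonsing_inv (cayley g₁ + cayley g₂) hC.isUnit
  have hCl := Matrix.nonsing_inv_mul (cayley g₁ + cayley g₂) hC.isUnit
  have e₁ := cayley_eq h₁
  have e₂ := cayley_eq h₂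
  rw [cayley_eq h₁₂]
  generalize hCdef : cayley g₁ + cayley g₂ = C at *
  have hinv : (g₁ * g₂ - 1)⁻¹ = 2 * ((g₂ - 1)⁻¹ * C⁻¹ * (g₁ - 1)⁻¹) := by
    refine Matrix.inv_eq_right_inv ?_
    calc (g₁ * g₂ - 1) * (2 * ((g₂ - 1)⁻¹ * C⁻¹ * (g₁ - 1)⁻¹))
        = ((2 : ZMod p) • (g₁ * g₂ - 1)) * ((g₂ - 1)⁻¹ * C⁻¹ * (g₁ - 1)⁻¹) := by
          rw [two_smul]; noncomm_ring
      _ = (g₁ - 1) * (C * (((g₂ - 1) * (g₂ - 1)⁻¹) * C⁻¹)) * (g₁ - 1)⁻¹ := by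
          rw [← hsum]; simp only [mul_assoc]
      _ = 1 := by rw [hu₂, one_mul, hCr, mul_one, hu₁]
  have hB : cayley g₂ + 1 = C - 2 * (g₁ - 1)⁻¹ := by
    rw [← hCdef, e₁]
    abel
  rw [hB, mul_sub, hCl, hinv, e₂]
  noncomm_ring

end Cayley

lemma matVec_mul (m n : Matrix (Fin 2) (Fin 2) (ZMod p)) (v : ZMod p × ZMod p) :
    matVec (m * n) v = matVec m (matVec n v) := by
  simp only [matVec, Matrix.mul_apply, Fin.sum_univ_two]
  ext <;> ring

lemma matVec_add (m n : Matrix (Fin 2) (Fin 2) (ZMod p)) (v : ZMod p × ZMod p) :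
    matVec (m + n) v = matVec m v + matVec n v := by
  ext <;> simp [matVec] <;> ring

lemma matVec_sub (m n : Matrix (Fin 2) (Fin 2) (ZMod p)) (v : ZMod p × ZMod p) :
    matVec (m - n) v = matVec m v - matVec n v := by
  ext <;> simp [matVec] <;> ring

lemma matVec_one (v : ZMod p × ZMod p) : matVec 1 v = v := by
  ext <;> simp [matVec]

/-- The twisted convolution of two Gaussian kernels attached to trace-zero matrices. -/
lemma sum_psi_twisted (hp : p ≠ 2) (A B : Matrix (Fin 2) (Fin 2) (ZMod p))
    (hA : A 1 1 = -A 0 0) (hB : B 1 1 = -B 0 0) (hC : (A + B).det ≠ 0) (u : ZMod p × ZMod p) :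
    ∑ v : ZMod p × ZMod p, psi p ((4 : ZMod p)⁻¹ * omg (matVec A v) v) *
        psi p ((4 : ZMod p)⁻¹ * omg (matVec B (u - v)) (u - v)) *
        psi p ((2 : ZMod p)⁻¹ * omg v (u - v)) =
      sgm p (-(A + B).det) * p *
        psi p ((4 : ZMod p)⁻¹ * omg (matVec (B - (B - 1) * ((A + B)⁻¹ * (B + 1))) u) u) := by
  have h2 := two_ne_zero_of_ne_two hp
  have h4 : (4 : ZMod p) = 2 ^ 2 := by norm_num
  set x := matVec ((A + B)⁻¹ * (B + 1)) u with hx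
  have hxu : matVec (A + B) x = matVec B u + u := by
    rw [hx, ← matVec_mul, ← mul_assoc, Matrix.mul_nonsing_inv _ hC.isUnit, one_mul, matVec_add,
      matVec_one]
  have hκ : matVec (B - (B - 1) * ((A + B)⁻¹ * (B + 1))) u =
      matVec B u - (matVec B x - x) := by
    rw [matVec_sub, matVec_mul, ← hx, matVec_sub, matVec_one]
  rw [hκ]
  have hx₁ := congrArg Prod.fst hxu
  have hx₂ := congrArg Prod.snd hxu
  simp only [matVec, Matrix.add_apply, Prod.fst_add, Prod.snd_add, hA, hB] at hx₁ hx₂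
  have hdet : -(A + B).det = (2 : ZMod p) ^ 2 ^ 2 * -((-(A 1 0 + B 1 0) / 4) *
      ((A 0 1 + B 0 1) / 4) - ((A 0 0 + B 0 0) / 4) ^ 2) := by
    rw [Matrix.det_fin_two]
    simp only [Matrix.add_apply, hA, hB, h4]
    field_simp
    ring
  have hdet' : (-(A 1 0 + B 1 0) / 4) * ((A 0 1 + B 0 1) / 4) - ((A 0 0 + B 0 0) / 4) ^ 2 ≠ 0 := by
    intro h
    rw [h] at hdet
    simp at hdet
    exact hC hdet
  rw [hdet, show (2 : ZMod p) ^ 2 ^ 2 = (2 ^ 2) ^ 2 by norm_num, sgm_sq_mul (pow_ne_zero 2 h2),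
    ← sum_psi_binary hp _ _ _ hdet', Finset.sum_mul, ← Equiv.sum_comp (Equiv.addRight x)]
  refine Finset.sum_congr rfl fun s _ => ?_
  simp only [← psi_add, Equiv.coe_addRight]
  congr 1
  simp only [omg, matVec, Prod.fst_add, Prod.snd_add, Prod.fst_sub, Prod.snd_sub, hA, hB, h4]
  field_simp
  linear_combination (2 * s.2 + x.2) * hx₁ - (2 * s.1 + x.1) * hx₂

/-- The Heisenberg relation for the operators `π(v, 0)`. -/
lemma heis_mul_heis (hp : p ≠ 2) (v w : ZMod p × ZMod p) :
    (heis p (v, 0) : Module.End ℂ (ZMod p → ℂ)) * heis p (w, 0) =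
      psi p ((2 : ZMod p)⁻¹ * omg v w) • heis p (v + w, 0) := by
  have h2 := two_ne_zero_of_ne_two hp
  refine LinearMap.ext fun f => funext fun x => ?_
  simp only [Module.End.mul_apply, heis, LinearMap.coe_mk, AddHom.coe_mk, LinearMap.smul_apply,
    Pi.smul_apply, smul_eq_mul, Prod.fst_add, Prod.snd_add, ← mul_assoc, ← psi_add, ← add_assoc]
  congr 2
  simp only [omg]
  field_simp
  ring

end Field

/-- Multiplicativity of the Weil kernels. -/
theorem stmt7 (p : ℕ) [Fact p.Prime] (hp : p ≠ 2)
    (g₁ g₂ : Matrix (Fin 2) (Fin 2) (ZMod p))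
    (hg₁ : g₁.det = 1) (hg₂ : g₂.det = 1)
    (hI₁ : (g₁ - 1).det ≠ 0) (hI₂ : (g₂ - 1).det ≠ 0) (hI₁₂ : (g₁ * g₂ - 1).det ≠ 0) :
    weilOp p g₁ ∘ₗ weilOp p g₂ = weilOp p (g₁ * g₂) := by
  have hC := det_cayley_add_cayley_ne_zero hp hI₁ hI₂ hI₁₂
  have hp0 : (p : ℂ) ≠ 0 := Nat.cast_ne_zero.mpr (NeZero.ne p)
  have hconv : (∑ v : ZMod p × ZMod p,
        psi p ((4 : ZMod p)⁻¹ * omg (matVec (cayley g₁) v) v) •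
          (heis p (v, 0) : Module.End ℂ (ZMod p → ℂ))) *
      (∑ w : ZMod p × ZMod p,
        psi p ((4 : ZMod p)⁻¹ * omg (matVec (cayley g₂) w) w) • heis p (w, 0)) =
      (sgm p (-(cayley g₁ + cayley g₂).det) * p) • ∑ u : ZMod p × ZMod p,
        psi p ((4 : ZMod p)⁻¹ * omg (matVec (cayley (g₁ * g₂)) u) u) • heis p (u, 0) := by
    have hv : ∀ v : ZMod p × ZMod p, ∑ w : ZMod p × ZMod p,
        (psi p ((4 : ZMod p)⁻¹ * omg (matVec (cayley g₁) v) v) •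
          (heis p (v, 0) : Module.End ℂ (ZMod p → ℂ))) *
        (psi p ((4 : ZMod p)⁻¹ * omg (matVec (cayley g₂) w) w) • heis p (w, 0)) =
        ∑ u : ZMod p × ZMod p, (psi p ((4 : ZMod p)⁻¹ * omg (matVec (cayley g₁) v) v) *
          psi p ((4 : ZMod p)⁻¹ * omg (matVec (cayley g₂) (u - v)) (u - v)) *
          psi p ((2 : ZMod p)⁻¹ * omg v (u - v))) • heis p (u, 0) := by
      intro v
      rw [← Equiv.sum_comp (Equiv.subRight v)]
      refine Finset.sum_congr rfl fun u _ => ?_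
      rw [Equiv.subRight_apply, smul_mul_smul_comm, heis_mul_heis hp, smul_smul,
        add_sub_cancel]
    rw [Finset.sum_mul_sum, Finset.sum_congr rfl fun v _ => hv v, Finset.sum_comm,
      Finset.smul_sum]
    refine Finset.sum_congr rfl fun u _ => ?_
    rw [← Finset.sum_smul, sum_psi_twisted hp _ _ (cayley_apply_one_one hg₁)
      (cayley_apply_one_one hg₂) hC, ← cayley_mul hp hI₁ hI₂ hI₁₂, smul_smul]
  rw [weilOp, weilOp, weilOp, ← Module.End.mul_eq_comp, smul_mul_smul_comm, smul_mul_smul_comm,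
    hconv, smul_smul, smul_smul, smul_smul,
    sgm_neg_det_cayley_add_one hp hg₁ hI₁, sgm_neg_det_cayley_add_one hp hg₂ hI₂,
    sgm_neg_det_cayley_add_one hp (by rw [Matrix.det_mul, hg₁, hg₂, one_mul]) hI₁₂,
    ← sgm_cocycle hp hI₁ hI₂]
  congr 1
  field_simp

end DFTWeil
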